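/- Let (𝔱,T) be a dataset with n ≥ 4 and suppose the exponential f is a best exponential approximation to (𝔱,T). Then there exist indices 1 ≤ i_1 < i_2 < i_3 < i_4 ≤ n such that f is a best exponential approximation to the sub-dataset ((t_{i_1},t_{i_2},t_{i_3},t_{i_4}),(T_{i_1},T_{i_2},T_{i_3},T_{i_4})). -/

import Mathlib

open Real

/-- A function is an exponential if it has the form `t ↦ a·exp(k·t)+b` with `k ≠ 0`. -/
def IsExp (g : ℝ → ℝ) : Prop :=
  ∃ a b k : ℝ, k ≠ 0 ∧ g = fun s => a * Real.exp (k * s) + b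

/-- Max-norm approximation error of `f` on the dataset `(t, T)`. -/
noncomputable def approxErr {n : ℕ} (t T : Fin n → ℝ) (f : ℝ → ℝ) : ℝ :=
  ⨆ i : Fin n, |f (t i) - T i|

theorem abs_sub_le_approxErr {n : ℕ} (t T : Fin n → ℝ) (f : ℝ → ℝ) (i : Fin n) :
    |f (t i) - T i| ≤ approxErr t T f :=
  le_ciSup (f := fun i => |f (t i) - T i|) (Set.finite_range _).bddAbove i

/-- A finite set of at most four indices on which no exponential has error below that of `f`
extends to a four-point sub-dataset for which `f` is a best approximation. -/
theorem exists_fin_four_of_card_le {n : ℕ} (hn : 4 ≤ n) {t T : Fin n → ℝ} {f : ℝ → ℝ}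
    (A : Finset (Fin n)) (hA : A.card ≤ 4)
    (h : ∀ g, IsExp g → ∃ i ∈ A, approxErr t T f ≤ |g (t i) - T i|) :
    ∃ s : Fin 4 → Fin n, StrictMono s ∧
      ∀ g : ℝ → ℝ, IsExp g → approxErr (t ∘ s) (T ∘ s) f ≤ approxErr (t ∘ s) (T ∘ s) g := by
  obtain ⟨B, hAB, hB⟩ := Finset.exists_superset_card_eq (n := 4) hA (by simpa using hn)
  refine ⟨B.orderEmbOfFin hB, (B.orderEmbOfFin hB).strictMono, fun g hg => ?_⟩
  obtain ⟨i, hi, hE⟩ := h g hg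
  have hi' : i ∈ Set.range (B.orderEmbOfFin hB) := by
    rw [Finset.range_orderEmbOfFin]
    exact hAB hi
  obtain ⟨j, rfl⟩ := hi'
  calc approxErr (t ∘ B.orderEmbOfFin hB) (T ∘ B.orderEmbOfFin hB) f
      ≤ approxErr t T f := ciSup_le fun l => abs_sub_le_approxErr t T f _
    _ ≤ _ := hE
    _ ≤ _ := abs_sub_le_approxErr (t ∘ B.orderEmbOfFin hB) (T ∘ B.orderEmbOfFin hB) g j

theorem monotone_or_antitone_mul_exp (a k : ℝ) :
    Monotone (fun s => a * Real.exp (k * s)) ∨ Antitone (fun s => a * Real.exp (k * s)) := by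
  rcases le_total 0 a with ha | ha <;> rcases le_total 0 k with hk | hk
  · exact Or.inl fun x y h => mul_le_mul_of_nonneg_left
      (Real.exp_le_exp.2 (mul_le_mul_of_nonneg_left h hk)) ha
  · exact Or.inr fun x y h => mul_le_mul_of_nonneg_left
      (Real.exp_le_exp.2 (mul_le_mul_of_nonpos_left h hk)) ha
  · exact Or.inr fun x y h => mul_le_mul_of_nonpos_left
      (Real.exp_le_exp.2 (mul_le_mul_of_nonneg_left h hk)) ha
  · exact Or.inl fun x y h => mul_le_mul_of_nonpos_left
      (Real.exp_le_exp.2 (mul_le_mul_of_nonpos_left h hk)) ha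

theorem hasDerivAt_mul_exp_add (a k b s : ℝ) :
    HasDerivAt (fun s => a * Real.exp (k * s) + b) (a * (Real.exp (k * s) * k)) s := by
  simpa using ((((hasDerivAt_id s).const_mul k).exp).const_mul a).add_const b

/-- The difference of two exponentials does not alternate in sign on four points. -/
theorem not_alternating_sub {f g : ℝ → ℝ} (hf : IsExp f) (hg : IsExp g) {σ p q r s : ℝ}
    (hpq : p < q) (hqr : q < r) (hrs : r < s)
    (hp : 0 < σ * (f p - g p)) (hq : σ * (f q - g q) < 0)
    (hr : 0 < σ * (f r - g r)) (hs : σ * (f s - g s) < 0) : False := by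
  obtain ⟨a, b, k, -, rfl⟩ := hf
  obtain ⟨a', b', k', -, rfl⟩ := hg
  set d : ℝ → ℝ := fun s => σ * ((a * Real.exp (k * s) + b) - (a' * Real.exp (k' * s) + b'))
  set D : ℝ → ℝ := fun s => σ * (a * (Real.exp (k * s) * k) - a' * (Real.exp (k' * s) * k'))
    with hD
  have hder : ∀ s, HasDerivAt d (D s) s := fun s =>
    ((hasDerivAt_mul_exp_add a k b s).sub (hasDerivAt_mul_exp_add a' k' b' s)).const_mul σ
  have hcont : Continuous d := continuous_iff_continuousAt.2 fun s => (hder s).continuousAt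
  have mvt : ∀ x y, x < y → ∃ z ∈ Set.Ioo x y, D z * (y - x) = d y - d x := fun x y hxy => by
    obtain ⟨z, hz, h⟩ := exists_hasDerivAt_eq_slope d D hxy hcont.continuousOn fun z _ => hder z
    exact ⟨z, hz, by rw [h, div_mul_cancel₀ _ (sub_pos.2 hxy).ne']⟩
  obtain ⟨x, hx, hx'⟩ := mvt p q hpq
  obtain ⟨y, hy, hy'⟩ := mvt q r hqr
  obtain ⟨z, hz, hz'⟩ := mvt r s hrs
  have hfac : ∀ s, D s =
      Real.exp (k * s) * (σ * a * k - (σ * a' * k') * Real.exp ((k' - k) * s)) := fun s => by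
    have : Real.exp (k' * s) = Real.exp (k * s) * Real.exp ((k' - k) * s) := by
      rw [← Real.exp_add]; ring_nf
    simp only [hD, this]; ring
  have hDx : D x < 0 := by
    by_contra! h
    have := mul_nonneg h (sub_pos.2 hpq).le
    linarith
  have hDy : 0 < D y := by
    by_contra! h
    have := mul_nonpos_of_nonpos_of_nonneg h (sub_pos.2 hqr).le
    linarith
  have hDz : D z < 0 := by
    by_contra! h
    have := mul_nonneg h (sub_pos.2 hrs).le
    linarith
  rw [hfac] at hDx hDy hDz
  have h1 := neg_of_mul_neg_right hDx (Real.exp_pos _).le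
  have h2 := pos_of_mul_pos_right hDy (Real.exp_pos _).le
  have h3 := neg_of_mul_neg_right hDz (Real.exp_pos _).le
  have hxy : x ≤ y := (hx.2.trans hy.1).le
  have hyz : y ≤ z := (hy.2.trans hz.1).le
  rcases monotone_or_antitone_mul_exp (σ * a' * k') (k' - k) with h | h
  · have := h hxy
    simp only at this
    linarith
  · have := h hyz
    simp only at this
    linarith

/-- An exponential minus a constant does not alternate in sign on three points. -/
theorem not_alternating_const_sub {g : ℝ → ℝ} (hg : IsExp g) {σ b p q r : ℝ}
    (hpq : p ≤ q) (hqr : q ≤ r)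
    (hp : 0 < σ * (b - g p)) (hq : σ * (b - g q) < 0) (hr : 0 < σ * (b - g r)) : False := by
  obtain ⟨a', b', k', -, rfl⟩ := hg
  rcases monotone_or_antitone_mul_exp (σ * a') k' with h | h
  · have := h hqr
    simp only at this
    nlinarith
  · have := h hpq
    simp only at this
    nlinarith

/-- The derivative of the residuals along a path of exponentials through `f` cannot point
inwards at every extremal index, unless `f` can be improved. -/
theorem exists_approxErr_lt {n : ℕ} [Nonempty (Fin n)] {t T : Fin n → ℝ} {a b k : ℝ}
    {f : ℝ → ℝ} (hf : f = fun s => a * Real.exp (k * s) + b) (hk : k ≠ 0) (α κ β : ℝ)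
    (h : ∀ i, |f (t i) - T i| = approxErr t T f →
      (f (t i) - T i) *
        (α * Real.exp (k * t i) + a * (Real.exp (k * t i) * (κ * t i)) + β) < 0) :
    ∃ g, IsExp g ∧ approxErr t T g < approxErr t T f := by
  set E := approxErr t T f
  let φ : ℝ → ℝ → ℝ := fun ε s => (a + ε * α) * Real.exp ((k + ε * κ) * s) + (b + ε * β)
  have hder : ∀ s, HasDerivAt (fun ε => φ ε s)
      (α * Real.exp (k * s) + a * (Real.exp (k * s) * (κ * s)) + β) 0 := fun s => by
    have lin : ∀ u v : ℝ, HasDerivAt (fun ε : ℝ => u + ε * v) v 0 := fun u v => by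
      simpa using ((hasDerivAt_id (0 : ℝ)).mul_const v).const_add u
    have := ((lin a α).mul (((lin k κ).mul_const s).exp)).add (lin b β)
    exact this.congr_deriv (by simp)
  have hφ0 : ∀ s, φ 0 s = f s := fun s => by simp [φ, hf]
  have hev : ∀ i, ∀ᶠ ε in nhdsWithin (0 : ℝ) (Set.Ioi 0), |φ ε (t i) - T i| < E := fun i => by
    have hd := (hder (t i)).sub_const (T i)
    rcases (abs_sub_le_approxErr t T f i).lt_or_eq with hlt | heq
    · have hc : ContinuousAt (fun ε => |φ ε (t i) - T i|) 0 := hd.continuousAt.abs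
      have := hc.tendsto.eventually_lt_const (u := E) (by simpa only [hφ0] using hlt)
      exact this.filter_mono nhdsWithin_le_nhds
    · have hsq := hd.pow 2
      have hneg := h i heq
      have hev := (hasDerivWithinAt_iff_tendsto_slope' (by simp)).1
        (hsq.hasDerivWithinAt (s := Set.Ioi 0))
      have hev' := hev.eventually_lt_const (u := 0) (by
        simp only [hφ0]
        norm_num
        linarith)
      filter_upwards [hev', self_mem_nhdsWithin] with ε hε hpos
      rw [slope_def_field] at hε
      have hpos' : (0 : ℝ) < ε := hpos
      have h1 := (div_neg_iff.1 hε).resolve_left fun h => by linarith [h.2]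
      have h2 : (φ ε (t i) - T i) ^ 2 < E ^ 2 := by
        have h3 : (f (t i) - T i) ^ 2 = E ^ 2 := by rw [← sq_abs, heq]
        have h4 := h1.1
        simp only [Pi.pow_apply, hφ0, h3] at h4
        linarith
      exact lt_of_pow_lt_pow_left₀ 2 ((abs_nonneg _).trans heq.le) (by rwa [sq_abs])
  have hk' : ∀ᶠ ε in nhdsWithin (0 : ℝ) (Set.Ioi 0), k + ε * κ ≠ 0 := by
    have hc : ContinuousAt (fun ε : ℝ => k + ε * κ) 0 := by fun_prop
    exact (hc.eventually_ne (by simpa using hk)).filter_mono nhdsWithin_le_nhds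
  obtain ⟨ε, hlt, hne⟩ := ((Filter.eventually_all.2 hev).and hk').exists
  refine ⟨φ ε, ⟨_, _, _, hne, rfl⟩, ?_⟩
  obtain ⟨i, hi⟩ := exists_eq_ciSup_of_finite (f := fun i => |φ ε (t i) - T i|)
  calc approxErr t T (φ ε) = |φ ε (t i) - T i| := hi.symm
    _ < E := hlt i

/-- A line crossing the graph of `s ↦ exp (-k s)` at two given points. -/
theorem exists_secant_exp {k x y : ℝ} (hk : k ≠ 0) (hxy : x < y) :
    ∃ m c : ℝ, (∀ s, s < x ∨ y < s → m * s + c < Real.exp (-k * s)) ∧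
      ∀ s, x < s → s < y → Real.exp (-k * s) < m * s + c := by
  set F : ℝ → ℝ := fun s => Real.exp (-k * s) with hF
  have hconv : StrictConvexOn ℝ Set.univ F := by
    refine ⟨convex_univ, fun u _ v _ huv p q hp hq hpq => ?_⟩
    have := strictConvexOn_exp.2 (Set.mem_univ (-k * u)) (Set.mem_univ (-k * v))
      (fun h => huv (mul_left_cancel₀ (neg_ne_zero.2 hk) h)) hp hq hpq
    convert this using 1
    simp only [hF, smul_eq_mul]
    ring_nf
  have key : ∀ u v w, u < v → v < w → (F v - F u) * (w - v) < (F w - F v) * (v - u) :=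
    fun u v w huv hvw => by
      have := hconv.slope_strict_mono_adjacent (Set.mem_univ u) (Set.mem_univ w) huv hvw
      rwa [div_lt_div_iff₀ (sub_pos.2 huv) (sub_pos.2 hvw)] at this
  have hpos := sub_pos.2 hxy
  have hm : (F y - F x) / (y - x) * (y - x) = F y - F x := div_mul_cancel₀ _ hpos.ne'
  set m := (F y - F x) / (y - x)
  refine ⟨m, F x - m * x, ?_, fun s h1 h2 => ?_⟩
  · rintro s (h | h)
    · have := key s x y h hxy
      change _ < F s
      by_contra! hc
      nlinarith
    · have := key x y s hxy h
      change _ < F s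
      by_contra! hc
      nlinarith
  · have := key x s y h1 h2
    change F s < _
    by_contra! hc
    nlinarith

/-- Either no index with property `N` lies beyond `y`, or there is a first one, and it can be
separated from everything before it. -/
theorem exists_first_beyond {ι : Type*} [Finite ι] (t : ι → ℝ) (N : ι → Prop) (y : ℝ) :
    (∀ j, N j → t j ≤ y) ∨ ∃ i x, N i ∧ y < x ∧ x < t i ∧ (∀ j, t j < t i → t j < x) ∧
      ∀ j, N j → y < t j → t i ≤ t j := by
  by_cases h : ∀ j, N j → t j ≤ y
  · exact Or.inl h
  right
  push Not at h
  obtain ⟨i, hi, hmin⟩ := Set.exists_min_image {j | N j ∧ y < t j} t (Set.toFinite _) h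
  have hlt : ∀ u, u < t i → ∀ᶠ x in nhdsWithin (t i) (Set.Iio (t i)), u < x := fun u hu =>
    (eventually_gt_nhds hu).filter_mono nhdsWithin_le_nhds
  have hall : ∀ᶠ x in nhdsWithin (t i) (Set.Iio (t i)), ∀ j, t j < t i → t j < x :=
    Filter.eventually_all.2 fun j => Filter.eventually_imp_distrib_left.2 (hlt _)
  obtain ⟨x, ⟨hx1, hx2⟩, hx3⟩ := ((hlt y hi.2).and hall |>.and self_mem_nhdsWithin).exists
  exact ⟨i, x, hi.1, hx1, hx3, hx2, fun j h1 h2 => hmin j ⟨h1, h2⟩⟩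

theorem alternate_three_or_separate {ι : Type*} [Finite ι] {t : ι → ℝ}
    (ht : Function.Injective t) {P N : ι → Prop} (hPN : ∀ i, P i → ¬ N i) {i₁ : ι} (h₁ : P i₁)
    (hmin : ∀ j, N j → t i₁ ≤ t j) :
    (∃ i₂ i₃, N i₂ ∧ P i₃ ∧ t i₁ < t i₂ ∧ t i₂ < t i₃) ∨
      ∃ x, (∀ j, P j → t j < x) ∧ ∀ j, N j → x < t j := by
  have hne : ∀ {i j}, P i → N j → t i ≠ t j := fun hi hj h => hPN _ hi (ht h ▸ hj)
  have hmin' : ∀ j, N j → t i₁ < t j := fun j hj => (hmin j hj).lt_of_ne (hne h₁ hj)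
  rcases exists_first_beyond t N (t i₁) with h | ⟨i₂, x, hN, hx₁, hx₂, hx, hfirst⟩
  · obtain ⟨M, hM⟩ := (Set.finite_range t).bddAbove
    exact Or.inr ⟨M + 1, fun j _ => (hM ⟨j, rfl⟩).trans_lt (lt_add_one M),
      fun j hj => absurd (hmin' j hj) (h j hj).not_gt⟩
  by_cases h3 : ∃ i₃, P i₃ ∧ t i₂ < t i₃
  · obtain ⟨i₃, hP, hlt⟩ := h3
    exact Or.inl ⟨i₂, i₃, hN, hP, hx₁.trans hx₂, hlt⟩
  push Not at h3
  exact Or.inr ⟨x, fun j hj => hx j ((h3 j hj).lt_of_ne (hne hj hN)),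
    fun j hj => hx₂.trans_le (hfirst j hj (hmin' j hj))⟩

theorem alternate_four_or_separate {ι : Type*} [Finite ι] {t : ι → ℝ}
    (ht : Function.Injective t) {P N : ι → Prop} (hPN : ∀ i, P i → ¬ N i) {i₁ : ι} (h₁ : P i₁)
    (hmin : ∀ j, N j → t i₁ ≤ t j) :
    (∃ i₂ i₃ i₄, N i₂ ∧ P i₃ ∧ N i₄ ∧ t i₁ < t i₂ ∧ t i₂ < t i₃ ∧ t i₃ < t i₄) ∨
      ∃ x y, x < y ∧ (∀ j, P j → t j < x ∨ y < t j) ∧ ∀ j, N j → x < t j ∧ t j < y := by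
  have hne : ∀ {i j}, P i → N j → t i ≠ t j := fun hi hj h => hPN _ hi (ht h ▸ hj)
  have hmin' : ∀ j, N j → t i₁ < t j := fun j hj => (hmin j hj).lt_of_ne (hne h₁ hj)
  obtain ⟨M, hM⟩ := (Set.finite_range t).bddAbove
  have hM' : ∀ j, t j < M + 1 := fun j => (hM ⟨j, rfl⟩).trans_lt (lt_add_one M)
  rcases exists_first_beyond t N (t i₁) with h | ⟨i₂, x, hN, hx₁, hx₂, hx, hfirst⟩
  · exact Or.inr ⟨M + 1, M + 2, by linarith, fun j _ => Or.inl (hM' j),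
      fun j hj => absurd (hmin' j hj) (h j hj).not_gt⟩
  have hxN : ∀ j, N j → x < t j := fun j hj => hx₂.trans_le (hfirst j hj (hmin' j hj))
  rcases exists_first_beyond t P (t i₂) with h | ⟨i₃, y, hP, hy₁, hy₂, hy, hfirst'⟩
  · exact Or.inr ⟨x, M + 1, hx₂.trans (hM' i₂),
      fun j hj => Or.inl (hx j ((h j hj).lt_of_ne (hne hj hN))), fun j hj => ⟨hxN j hj, hM' j⟩⟩
  by_cases h4 : ∃ i₄, N i₄ ∧ t i₃ < t i₄
  · obtain ⟨i₄, hN', hlt⟩ := h4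
    exact Or.inl ⟨i₂, i₃, i₄, hN, hP, hN', hx₁.trans hx₂, hy₁.trans hy₂, hlt⟩
  push Not at h4
  refine Or.inr ⟨x, y, hx₂.trans hy₁, fun j hj => ?_,
    fun j hj => ⟨hxN j hj, hy j ((h4 j hj).lt_of_ne (hne hP hj).symm)⟩⟩
  rcases (hne hj hN).lt_or_gt with h | h
  · exact Or.inl (hx j h)
  · exact Or.inr (hy₂.trans_le (hfirst' j hj h))

/-- If `f` is a best exponential approximation to a dataset with `n ≥ 4`,
then there are indices `i₁ < i₂ < i₃ < i₄` such that `f` is a best exponential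
approximation to the corresponding sub-dataset of four points. -/
theorem stmt_14 (n : ℕ) (hn : 4 ≤ n) (t T : Fin n → ℝ) (ht : StrictMono t)
    (f : ℝ → ℝ) (hf : IsExp f)
    (hbest : ∀ g : ℝ → ℝ, IsExp g → approxErr t T f ≤ approxErr t T g) :
    ∃ s : Fin 4 → Fin n, StrictMono s ∧
      ∀ g : ℝ → ℝ, IsExp g → approxErr (t ∘ s) (T ∘ s) f ≤ approxErr (t ∘ s) (T ∘ s) g := by
  have : Nonempty (Fin n) := ⟨⟨0, by omega⟩⟩
  obtain ⟨i₀, hi₀⟩ := exists_eq_ciSup_of_finite (f := fun i => |f (t i) - T i|)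
  change _ = approxErr t T f at hi₀
  set E := approxErr t T f
  rcases le_or_gt E 0 with hE0 | hE0
  · exact exists_fin_four_of_card_le hn {i₀} (by simp) fun g _ =>
      ⟨i₀, by simp, hE0.trans (abs_nonneg _)⟩
  obtain ⟨i₁, hi₁, hmin⟩ := Set.exists_min_image {i | |f (t i) - T i| = E} t
    (Set.toFinite _) ⟨i₀, hi₀⟩
  obtain ⟨σ, hσ, hP₁⟩ : ∃ σ : ℝ, (σ = 1 ∨ σ = -1) ∧ σ * (f (t i₁) - T i₁) = E := by
    rcases (abs_eq hE0.le).1 hi₁ with h | h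
    · exact ⟨1, Or.inl rfl, by rw [h, one_mul]⟩
    · exact ⟨-1, Or.inr rfl, by rw [h]; ring⟩
  have hext : ∀ i, |f (t i) - T i| = E →
      σ * (f (t i) - T i) = E ∨ σ * (f (t i) - T i) = -E := fun i hi => by
    rcases hσ with rfl | rfl <;> rcases (abs_eq hE0.le).1 hi with h | h <;> rw [h] <;> simp
  have habs : ∀ x : ℝ, |σ * x| = |x| := fun x => by rcases hσ with rfl | rfl <;> simp
  have hσσ : σ * σ = 1 := by rcases hσ with rfl | rfl <;> norm_num
  have hPN : ∀ i, σ * (f (t i) - T i) = E → ¬ σ * (f (t i) - T i) = -E :=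
    fun i h h' => by linarith
  have hmin' : ∀ j, σ * (f (t j) - T j) = -E → t i₁ ≤ t j := fun j hj =>
    hmin j (by rw [Set.mem_ofPred_eq, ← habs, hj, abs_neg, abs_of_pos hE0])
  have hpos : ∀ {g : ℝ → ℝ} {i}, |g (t i) - T i| < E → σ * (f (t i) - T i) = E →
      0 < σ * (f (t i) - g (t i)) := fun {g i} hg hi => by
    rw [← habs, abs_lt] at hg
    linarith [hg.2]
  have hneg : ∀ {g : ℝ → ℝ} {i}, |g (t i) - T i| < E → σ * (f (t i) - T i) = -E →
      σ * (f (t i) - g (t i)) < 0 := fun {g i} hg hi => by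
    rw [← habs, abs_lt] at hg
    linarith [hg.1]
  have hmul : ∀ r d : ℝ, r * (σ * d) = σ * r * d := fun r d => by ring
  obtain ⟨a, b, k, hk, hfab⟩ := id hf
  rcases eq_or_ne a 0 with rfl | ha
  · have hfb : f = fun s => 0 * Real.exp (1 * s) + b := by simp [hfab]
    rcases alternate_three_or_separate ht.injective hPN hP₁ hmin' with
      ⟨i₂, i₃, h₂, h₃, h₁₂, h₂₃⟩ | ⟨x, hxP, hxN⟩
    · refine exists_fin_four_of_card_le hn {i₁, i₂, i₃} (Finset.card_le_three.trans (by norm_num))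
        fun g hg => ?_
      by_contra! hlt
      have hc : ∀ s, f s = b := fun s => by simp [hfb]
      have q₁ := hpos (hlt i₁ (by simp)) hP₁
      have q₂ := hneg (hlt i₂ (by simp)) h₂
      have q₃ := hpos (hlt i₃ (by simp)) h₃
      rw [hc] at q₁ q₂ q₃
      exact not_alternating_const_sub hg h₁₂.le h₂₃.le q₁ q₂ q₃
    · obtain ⟨g, hg, hlt⟩ := exists_approxErr_lt (t := t) (T := T) hfb one_ne_zero
        σ 0 (-σ * Real.exp x) fun i hi => by
          have : σ * Real.exp (1 * t i) + 0 * (Real.exp (1 * t i) * (0 * t i))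
              + -σ * Real.exp x = σ * (Real.exp (t i) - Real.exp x) := by
            rw [one_mul]; ring
          rw [this, hmul]
          rcases hext i hi with h | h
          · rw [h]
            exact mul_neg_of_pos_of_neg hE0 (sub_neg.2 (Real.exp_lt_exp.2 (hxP i h)))
          · rw [h]
            exact mul_neg_of_neg_of_pos (neg_neg_of_pos hE0)
              (sub_pos.2 (Real.exp_lt_exp.2 (hxN i h)))
      exact absurd (hbest g hg) hlt.not_ge
  · rcases alternate_four_or_separate ht.injective hPN hP₁ hmin' with
      ⟨i₂, i₃, i₄, h₂, h₃, h₄, h₁₂, h₂₃, h₃₄⟩ | ⟨x, y, hxy, hP, hN⟩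
    · refine exists_fin_four_of_card_le hn {i₁, i₂, i₃, i₄} Finset.card_le_four fun g hg => ?_
      by_contra! hlt
      exact not_alternating_sub hf hg h₁₂ h₂₃ h₃₄ (hpos (hlt i₁ (by simp)) hP₁)
        (hneg (hlt i₂ (by simp)) h₂) (hpos (hlt i₃ (by simp)) h₃) (hneg (hlt i₄ (by simp)) h₄)
    · obtain ⟨m, c, hout, hin⟩ := exists_secant_exp hk hxy
      obtain ⟨g, hg, hlt⟩ := exists_approxErr_lt (t := t) (T := T) hfab hk
        (σ * c) (σ * m / a) (-σ) fun i hi => by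
          have hinv : Real.exp (k * t i) * Real.exp (-k * t i) = 1 := by
            rw [← Real.exp_add]; simp
          have : σ * c * Real.exp (k * t i) + a * (Real.exp (k * t i) * (σ * m / a * t i)) + -σ
              = σ * (Real.exp (k * t i) * (m * t i + c - Real.exp (-k * t i))) := by
            rw [mul_sub (Real.exp _), hinv]
            field_simp
            ring
          rw [this, hmul]
          have he := Real.exp_pos (k * t i)
          rcases hext i hi with h | h
          · rw [h]
            exact mul_neg_of_pos_of_neg hE0
              (mul_neg_of_pos_of_neg he (sub_neg.2 (hout _ (hP i h))))
          · rw [h]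
            exact mul_neg_of_neg_of_pos (neg_neg_of_pos hE0)
              (mul_pos he (sub_pos.2 (hin _ (hN i h).1 (hN i h).2)))
      exact absurd (hbest g hg) hlt.not_ge
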